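/- Let A, B be positive integers, Q ∈ ℝ^{A×B} with ‖Q‖_F ≠ 0, t ≥ 0 and s a positive integer. Then the minimum of ⟨Q,X⟩_F over {X ∈ ℝ^{A×B} : ‖X‖_F² ≤ t², ‖X‖₀ ≤ s, X ≥ 0} equals −t·σ_s(Π₊(−Q)), where σ_s(Y) = max over index sets S ⊆ {1,…,A}×{1,…,B} with |S| ≤ s of √(∑_{(i,j)∈S} Y_{ij}²). Moreover, if σ_s(Π₊(−Q)) ≠ 0 the minimum over {X : ‖X‖_F² = t², ‖X‖₀ ≤ s, X ≥ 0} has the same value. -/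

import Mathlib

/-- Frobenius inner product of real matrices. -/
noncomputable def fip {m n : ℕ} (X Y : Matrix (Fin m) (Fin n) ℝ) : ℝ :=
  ∑ i, ∑ j, X i j * Y i j

/-- Frobenius norm of a real matrix. -/
noncomputable def fnorm {m n : ℕ} (X : Matrix (Fin m) (Fin n) ℝ) : ℝ :=
  Real.sqrt (fip X X)

/-- Number of nonzero entries of a matrix (the ℓ0 "norm"). -/
noncomputable def l0 {m n : ℕ} (X : Matrix (Fin m) (Fin n) ℝ) : ℕ :=
  (Finset.univ.filter fun p : Fin m × Fin n => X p.1 p.2 ≠ 0).card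

/-- Entrywise positive part Π₊. -/
def pp {m n : ℕ} (Y : Matrix (Fin m) (Fin n) ℝ) : Matrix (Fin m) (Fin n) ℝ :=
  fun i j => max (Y i j) 0

/-- σ_s(Y): the maximum over index sets S of cardinality ≤ s of √(∑_{(i,j)∈S} Y_{ij}²). -/
noncomputable def sigS {m n : ℕ} (s : ℕ) (Q : Matrix (Fin m) (Fin n) ℝ) : ℝ :=
  (Finset.univ.filter fun S : Finset (Fin m × Fin n) => S.card ≤ s).sup'
    ⟨∅, by simp⟩ (fun S => Real.sqrt (∑ p ∈ S, Q p.1 p.2 ^ 2))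

theorem fip_eq_sum_prod {m n : ℕ} (X Y : Matrix (Fin m) (Fin n) ℝ) :
    fip X Y = ∑ p : Fin m × Fin n, X p.1 p.2 * Y p.1 p.2 := by
  rw [fip, Fintype.sum_prod_type]

theorem fnorm_sq {m n : ℕ} (X : Matrix (Fin m) (Fin n) ℝ) :
    fnorm X ^ 2 = ∑ p : Fin m × Fin n, X p.1 p.2 ^ 2 := by
  rw [fnorm, Real.sq_sqrt]
  · simp only [fip_eq_sum_prod, sq]
  · rw [fip_eq_sum_prod]
    exact Finset.sum_nonneg fun p _ => mul_self_nonneg _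

theorem sqrt_sum_sq_le_sigS {m n : ℕ} {s : ℕ} (Y : Matrix (Fin m) (Fin n) ℝ)
    {S : Finset (Fin m × Fin n)} (hS : S.card ≤ s) :
    Real.sqrt (∑ p ∈ S, Y p.1 p.2 ^ 2) ≤ sigS s Y :=
  Finset.le_sup' (fun S : Finset (Fin m × Fin n) => Real.sqrt (∑ p ∈ S, Y p.1 p.2 ^ 2))
    (by simpa using hS)

theorem exists_sigS_eq {m n : ℕ} (s : ℕ) (Y : Matrix (Fin m) (Fin n) ℝ) :
    ∃ S : Finset (Fin m × Fin n), S.card ≤ s ∧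
      sigS s Y = Real.sqrt (∑ p ∈ S, Y p.1 p.2 ^ 2) := by
  obtain ⟨S, hS, h⟩ := Finset.exists_mem_eq_sup'
    (s := Finset.univ.filter fun S : Finset (Fin m × Fin n) => S.card ≤ s) ⟨∅, by simp⟩
    (fun S => Real.sqrt (∑ p ∈ S, Y p.1 p.2 ^ 2))
  exact ⟨S, by simpa using hS, h⟩

theorem neg_mul_sigS_le_fip {m n : ℕ} {s : ℕ} {t : ℝ} (ht : 0 ≤ t)
    (Q : Matrix (Fin m) (Fin n) ℝ) {X : Matrix (Fin m) (Fin n) ℝ}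
    (hX : fnorm X ^ 2 ≤ t ^ 2) (hs : l0 X ≤ s) (h0 : ∀ i j, 0 ≤ X i j) :
    -(t * sigS s (pp (-Q))) ≤ fip Q X := by
  set S := Finset.univ.filter fun p : Fin m × Fin n => X p.1 p.2 ≠ 0 with hSdef
  have hsupp : fip Q X = ∑ p ∈ S, Q p.1 p.2 * X p.1 p.2 := by
    rw [fip_eq_sum_prod]
    refine (Finset.sum_subset (Finset.subset_univ S) fun p _ hp => ?_).symm
    have : X p.1 p.2 = 0 := by simpa [hSdef] using hp
    rw [this, mul_zero]
  have hpos : -fip Q X ≤ ∑ p ∈ S, pp (-Q) p.1 p.2 * X p.1 p.2 := by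
    rw [hsupp, ← Finset.sum_neg_distrib]
    refine Finset.sum_le_sum fun p _ => ?_
    rw [← neg_mul]
    exact mul_le_mul_of_nonneg_right (le_max_left _ _) (h0 _ _)
  have hnorm : Real.sqrt (∑ p ∈ S, X p.1 p.2 ^ 2) ≤ t := by
    refine Real.sqrt_le_iff.2 ⟨ht, le_trans ?_ hX⟩
    rw [fnorm_sq]
    exact Finset.sum_le_sum_of_subset_of_nonneg (Finset.subset_univ S)
      fun p _ _ => sq_nonneg _
  have hcs := Real.sum_mul_le_sqrt_mul_sqrt S (fun p => pp (-Q) p.1 p.2) (fun p => X p.1 p.2)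
  have hmul := mul_le_mul (sqrt_sum_sq_le_sigS (pp (-Q)) (S := S) hs) hnorm
    (Real.sqrt_nonneg _) ((Real.sqrt_nonneg _).trans (sqrt_sum_sq_le_sigS _ (S := S) hs))
  linarith

theorem exists_fip_eq_of_sigS_ne_zero {m n : ℕ} {s : ℕ} {t : ℝ} (ht : 0 ≤ t)
    (Q : Matrix (Fin m) (Fin n) ℝ) (hσ : sigS s (pp (-Q)) ≠ 0) :
    ∃ X : Matrix (Fin m) (Fin n) ℝ, (fnorm X ^ 2 = t ^ 2 ∧ l0 X ≤ s ∧ ∀ i j, 0 ≤ X i j) ∧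
      fip Q X = -(t * sigS s (pp (-Q))) := by
  obtain ⟨S, hS, h⟩ := exists_sigS_eq s (pp (-Q))
  have hσ0 : 0 ≤ sigS s (pp (-Q)) := h ▸ Real.sqrt_nonneg _
  have hsq : ∑ p ∈ S, pp (-Q) p.1 p.2 ^ 2 = sigS s (pp (-Q)) ^ 2 := by
    rw [h, Real.sq_sqrt (Finset.sum_nonneg fun p _ => sq_nonneg _)]
  set σ := sigS s (pp (-Q))
  refine ⟨.of fun i j => if (i, j) ∈ S then t / σ * pp (-Q) i j else 0, ⟨?_, ?_, ?_⟩, ?_⟩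
  · simp only [fnorm_sq, Matrix.of_apply, Prod.mk.eta, ite_pow, mul_pow, ne_eq, OfNat.ofNat_ne_zero,
      not_false_eq_true, zero_pow, Finset.sum_ite_mem, Finset.univ_inter]
    rw [← Finset.mul_sum, hsq]
    field_simp
  · refine (Finset.card_le_card fun p hp => ?_).trans hS
    by_contra hpS
    simp [hpS] at hp
  · intro i j
    rw [Matrix.of_apply]
    split_ifs
    · exact mul_nonneg (div_nonneg ht hσ0) (le_max_right _ _)
    · exact le_rfl
  · have key : ∀ x : ℝ, x * max (-x) 0 = -max (-x) 0 ^ 2 := fun x => by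
      rcases le_total (-x) 0 with hx | hx <;> simp [hx, sq]
    have hterm : ∀ p : Fin m × Fin n, Q p.1 p.2 * (t / σ * pp (-Q) p.1 p.2) =
        -(t / σ) * pp (-Q) p.1 p.2 ^ 2 := fun p => by
      have : Q p.1 p.2 * pp (-Q) p.1 p.2 = -pp (-Q) p.1 p.2 ^ 2 := key (Q p.1 p.2)
      linear_combination (t / σ) * this
    simp only [fip_eq_sum_prod, Matrix.of_apply, Prod.mk.eta, mul_ite, mul_zero, Finset.sum_ite_mem,
      Finset.univ_inter, hterm]
    rw [← Finset.mul_sum, hsq]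
    field_simp

/-- minimum of ⟨Q,X⟩_F over the nonnegative s-sparse part of the Frobenius
ball of radius t equals −t·σ_s(Π₊(−Q)); if σ_s(Π₊(−Q)) ≠ 0 then the minimum over the
corresponding sphere set has the same value. -/
theorem stmt7 (A B : ℕ) (hA : 0 < A) (hB : 0 < B)
    (Q : Matrix (Fin A) (Fin B) ℝ) (hQ : fnorm Q ≠ 0) (t : ℝ) (ht : 0 ≤ t)
    (s : ℕ) (hs : 0 < s) :
    IsLeast ((fun X : Matrix (Fin A) (Fin B) ℝ => fip Q X) ''
        {X | fnorm X ^ 2 ≤ t ^ 2 ∧ l0 X ≤ s ∧ ∀ i j, 0 ≤ X i j})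
      (-(t * sigS s (pp (-Q)))) ∧
    (sigS s (pp (-Q)) ≠ 0 →
      IsLeast ((fun X : Matrix (Fin A) (Fin B) ℝ => fip Q X) ''
          {X | fnorm X ^ 2 = t ^ 2 ∧ l0 X ≤ s ∧ ∀ i j, 0 ≤ X i j})
        (-(t * sigS s (pp (-Q))))) := by
  have lower : ∀ X : Matrix (Fin A) (Fin B) ℝ,
      fnorm X ^ 2 ≤ t ^ 2 ∧ l0 X ≤ s ∧ (∀ i j, 0 ≤ X i j) →
        -(t * sigS s (pp (-Q))) ≤ fip Q X :=
    fun X hX => neg_mul_sigS_le_fip ht Q hX.1 hX.2.1 hX.2.2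
  refine ⟨⟨?_, ?_⟩, fun hσ => ⟨exists_fip_eq_of_sigS_ne_zero ht Q hσ, ?_⟩⟩
  · by_cases hσ : sigS s (pp (-Q)) = 0
    · refine ⟨0, ⟨?_, ?_, ?_⟩, ?_⟩
      · simpa [fnorm_sq] using sq_nonneg t
      · simp [l0]
      · simp
      · simp [fip, hσ]
    · obtain ⟨X, ⟨hX, hX'⟩, h⟩ := exists_fip_eq_of_sigS_ne_zero ht Q hσ
      exact ⟨X, ⟨hX.le, hX'⟩, h⟩
  · rintro _ ⟨X, hX, rfl⟩
    exact lower X hX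
  · rintro _ ⟨X, ⟨hX, hX'⟩, rfl⟩
    exact lower X ⟨hX.le, hX'⟩
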